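/- arXiv:math/0612187 — 4 statements merged into one kernel-verified Lean document; each statement's English description precedes it below -/
import Mathlib

section
/- Let r ≥ 1, n ≥ 0, and π = (z, τ) ∈ G_{r,n}. Extend π to a map on the set Σ = [n] × {0, …, r−1} of colored letters by π(i^{[a]}) = τ(i)^{[(a + z_{τ(i)}) mod r]}. Then the number of excedances of π with respect to the color order, #{x ∈ Σ : π(x) > x}, equals exc^Clr(π) = r·exc_A(π) + csum(π). -/
open Finset MvPolynomial

/-- The colored permutation group `G_{r,n}`: pairs `(z, τ)` with `z : (ℤ/rℤ)ⁿ`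
and `τ` a permutation of `[n]`. -/
abbrev ColoredPerm (r n : ℕ) : Type := (Fin n → ZMod r) × Equiv.Perm (Fin n)

/-- Multiplication in `G_{r,n}`:
`(z, τ)(z', τ') = ((zᵢ + z'_{τ⁻¹(i)})ᵢ, τ ∘ τ')`. -/
def cpMul {r n : ℕ} (x y : ColoredPerm r n) : ColoredPerm r n :=
  (fun i => x.1 i + y.1 (x.2⁻¹ i), x.2 * y.2)

/-- The identity element of `G_{r,n}`. -/
def cpOne (r n : ℕ) : ColoredPerm r n := (fun _ => 0, 1)

/-- `π` is an involution: `π² = 1`. -/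
def IsCPInvolution {r n : ℕ} (π : ColoredPerm r n) : Prop := cpMul π π = cpOne r n

instance {r n : ℕ} (π : ColoredPerm r n) : Decidable (IsCPInvolution π) :=
  decidable_of_iff (cpMul π π = cpOne r n) Iff.rfl

/-- `csum π = Σᵢ zᵢ(π)`, each color regarded as an integer in `{0, …, r−1}`. -/
def csum {r n : ℕ} (π : ColoredPerm r n) : ℕ := ∑ i, (π.1 i).val

/-- `fix π`: the number of absolute fixed points, `#{i ∈ [n] : τ(i) = i}`. -/
noncomputable def fixc {r n : ℕ} (π : ColoredPerm r n) : ℕ := Nat.card {i : Fin n // π.2 i = i}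

/-- `exc_A π = #{i ∈ {1, …, n−1} : z_{τ(i)}(π) = 0 and τ(i) > i}`
(`Fin n` encodes `[n]` via `i ↦ i + 1`, so `i ∈ {1, …, n−1}` reads `(i : ℕ) + 1 < n`). -/
noncomputable def excA {r n : ℕ} (π : ColoredPerm r n) : ℕ :=
  Nat.card {i : Fin n // (i : ℕ) + 1 < n ∧ π.1 (π.2 i) = 0 ∧ i < π.2 i}

/-- The colored excedance number `exc^Clr π = r·exc_A π + csum π`. -/
noncomputable def excClr {r n : ℕ} (π : ColoredPerm r n) : ℕ := r * excA π + csum π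

/-- The color order on the colored letters `i^{[a]}`:
`i^{[a]} < j^{[b]}` iff `a > b`, or `a = b` and `i < j`. -/
def colorLt {r n : ℕ} (x y : Fin n × ZMod r) : Prop :=
  y.2.val < x.2.val ∨ (x.2 = y.2 ∧ x.1 < y.1)

/-- The extension of `π = (z, τ) ∈ G_{r,n}` to the colored letters:
`π(i^{[a]}) = τ(i)^{[(a + z_{τ(i)}) mod r]}`. -/
def extMap {r n : ℕ} (π : ColoredPerm r n) (x : Fin n × ZMod r) : Fin n × ZMod r :=
  (π.2 x.1, x.2 + π.1 (π.2 x.1))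

theorem ZMod.val_add_lt_val_left_iff {r : ℕ} [NeZero r] (a z : ZMod r) :
    (a + z).val < a.val ↔ (a + z).val < z.val := by
  have ha := a.val_lt
  have hz := z.val_lt
  rcases lt_or_ge (a.val + z.val) r with h | h
  · rw [ZMod.val_add_of_lt h]
    omega
  · have := ZMod.val_add_val_of_le h
    omega

theorem ZMod.card_filter_val_lt {r : ℕ} [NeZero r] {k : ℕ} (hk : k ≤ r) :
    #{b : ZMod r | b.val < k} = k := by
  rw [← card_range k]
  refine card_bij (fun b _ => b.val) (by simp) (fun _ _ _ _ h => ZMod.val_injective r h) ?_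
  intro m hm
  have hm' : m < k := by simpa using hm
  have hval : (m : ZMod r).val = m := ZMod.val_cast_of_lt (hm'.trans_le hk)
  exact ⟨m, by simpa [hval] using hm', hval⟩

theorem ZMod.card_filter_val_add_lt {r : ℕ} [NeZero r] (z : ZMod r) :
    #{a : ZMod r | (a + z).val < a.val} = z.val := by
  rw [← ZMod.card_filter_val_lt z.val_lt.le]
  exact card_equiv (Equiv.addRight z) (by simp [ZMod.val_add_lt_val_left_iff])

open Classical in
/-- The number of excedances of the extension of `π` among the `r` colored copies of `i`. -/
theorem card_filter_colorLt_extMap {r n : ℕ} [NeZero r] (π : ColoredPerm r n) (i : Fin n) :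
    #{a : ZMod r | colorLt (i, a) (extMap π (i, a))} =
      (if π.1 (π.2 i) = 0 ∧ i < π.2 i then r else 0) + (π.1 (π.2 i)).val := by
  simp only [colorLt, extMap, left_eq_add]
  by_cases h : π.1 (π.2 i) = 0 ∧ i < π.2 i
  · simp [h, ZMod.card]
  · simp [h, ZMod.card_filter_val_add_lt]

theorem excA_eq_card_filter {r n : ℕ} (π : ColoredPerm r n) :
    excA π = #{i : Fin n | π.1 (π.2 i) = 0 ∧ i < π.2 i} := by
  rw [excA, Nat.card_eq_fintype_card, Fintype.card_subtype]
  congr 1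
  ext i
  have := (π.2 i).isLt
  simp only [mem_filter_univ, Fin.lt_def]
  constructor <;> intro h <;> simp_all
  omega

/-- The number of excedances of the extension of `π` to the set
`Σ = [n] × {0, …, r−1}` of colored letters, with respect to the color order,
equals `exc^Clr π = r·exc_A π + csum π`. -/
theorem card_excedances_eq_excClr (r n : ℕ) (hr : 1 ≤ r) (π : ColoredPerm r n) :
    Nat.card {x : Fin n × ZMod r // colorLt x (extMap π x)} = excClr π := by
  classical
  have : NeZero r := ⟨by omega⟩
  calc Nat.card {x : Fin n × ZMod r // colorLt x (extMap π x)}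
      = ∑ i, #{a : ZMod r | colorLt (i, a) (extMap π (i, a))} := by
        simp only [Nat.card_eq_fintype_card, Fintype.card_subtype, card_filter,
          Fintype.sum_prod_type]
    _ = r * excA π + ∑ i, (π.1 (π.2 i)).val := by
        simp only [card_filter_colorLt_extMap, sum_add_distrib]
        rw [excA_eq_card_filter, ← sum_filter, sum_const, smul_eq_mul, mul_comm]
    _ = excClr π := by
        rw [excClr, csum, Equiv.sum_comp π.2 fun j => (π.1 j).val]
end

section
/- Let r ≥ 1 and set μ_r = 1 + w^{r/2} if r is even and μ_r = 1 if r is odd. Then f_{r,1,0}(u,v,w) = 1, f_{r,1,1}(u,v,w) = u·μ_r, and for all n ≥ 2, f_{r,1,n}(u,v,w) = u·μ_r·f_{r,1,n−1}(u,v,w) + (n−1)(v + (r−1)w^r)·f_{r,1,n−2}(u,v,w). -/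
open Finset MvPolynomial

/-- `f_{r,p,n}(u,v,w) = Σ_{π ∈ I_{r,p,n}} u^{fix π} v^{exc_A π} w^{csum π}` in
`ℤ[u,v,w]`, where `I_{r,p,n}` is the set of involutions `π` of `G_{r,n}` with
`csum π ≡ 0 (mod p)`; the variables `u, v, w` are `X 0, X 1, X 2`. -/
noncomputable def fpoly (r p n : ℕ) [NeZero r] : MvPolynomial (Fin 3) ℤ :=
  ∑ π : ColoredPerm r n,
    if IsCPInvolution π ∧ p ∣ csum π then
      X 0 ^ fixc π * X 1 ^ excA π * X 2 ^ csum π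
    else 0

/-- `μ_r = 1 + w^{r/2}` for even `r` and `μ_r = 1` for odd `r`, in `ℤ[u,v,w]`. -/
noncomputable def muZ (r : ℕ) : MvPolynomial (Fin 3) ℤ :=
  if Even r then 1 + X 2 ^ (r / 2) else 1

/-- The number of fixed points of a permutation. -/
def fixCount {α : Type*} [Fintype α] [DecidableEq α] (τ : Equiv.Perm α) : ℕ :=
  ∑ i, if τ i = i then 1 else 0

/-- The weight `a ^ #{fixed points} * b ^ #{2-cycles}` of an involution. -/
def involutionWeight {R α : Type*} [CommRing R] [Fintype α] [DecidableEq α] (a b : R)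
    (τ : Equiv.Perm α) : R :=
  a ^ fixCount τ * b ^ ((Fintype.card α - fixCount τ) / 2)

/-- The sum of the weights of the involutions of `α`. -/
def involutionSum {R : Type*} [CommRing R] (a b : R) (α : Type*) [Fintype α] [DecidableEq α] : R :=
  ∑ τ : Equiv.Perm α, if τ * τ = 1 then involutionWeight a b τ else 0

theorem mul_self_permCongr_iff {α β : Type*} (e : α ≃ β) (τ : Equiv.Perm α) :
    e.permCongr τ * e.permCongr τ = 1 ↔ τ * τ = 1 := by
  rw [← Equiv.permCongr_mul, ← (e.permCongr).injective.eq_iff (a := τ * τ)]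
  simp [Equiv.Perm.one_def]

theorem mul_self_optionCongr_iff {α : Type*} (τ : Equiv.Perm α) :
    (Equiv.optionCongr τ : Equiv.Perm (Option α)) * Equiv.optionCongr τ = 1 ↔ τ * τ = 1 := by
  simp [Equiv.ext_iff, Option.forall]

theorem mul_self_swap_mul_optionCongr_iff {α : Type*} [DecidableEq α] (τ : Equiv.Perm α) (y : α) :
    (Equiv.swap none (some y) * Equiv.optionCongr τ : Equiv.Perm (Option α)) *
        (Equiv.swap none (some y) * Equiv.optionCongr τ) = 1 ↔ τ * τ = 1 ∧ τ y = y := by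
  constructor
  · intro h
    have hy : τ y = y := by
      have := Equiv.ext_iff.1 h none
      simpa [Equiv.swap_apply_eq_iff] using this
    refine ⟨?_, hy⟩
    ext x
    by_cases hx : x = y
    · simp [hx, hy]
    · have h1 : τ x ≠ y := fun h => hx (τ.injective (h.trans hy.symm))
      have := Equiv.ext_iff.1 h (some x)
      simpa [Equiv.swap_apply_of_ne_of_ne, h1, Equiv.swap_apply_eq_iff, hx] using this
  · rintro ⟨h, hy⟩
    have hh : ∀ x, τ (τ x) = x := fun x => Equiv.ext_iff.1 h x
    ext1 x
    rcases x with _ | x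
    · simp [hy]
    · by_cases hx : x = y
      · simp [hx, hy]
      · have h1 : τ x ≠ y := fun h => hx (τ.injective (h.trans hy.symm))
        simp [Equiv.swap_apply_of_ne_of_ne, h1, hx, hh]

section Involutions

variable {R α β : Type*} [CommRing R] [Fintype α] [DecidableEq α] [Fintype β] [DecidableEq β]

theorem fixCount_le_card (τ : Equiv.Perm α) : fixCount τ ≤ Fintype.card α := by
  unfold fixCount
  rw [← Finset.card_filter]
  exact Finset.card_le_univ _

theorem fixCount_permCongr (e : α ≃ β) (τ : Equiv.Perm α) :
    fixCount (e.permCongr τ) = fixCount τ := by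
  unfold fixCount
  rw [← e.sum_comp]
  simp

theorem involutionWeight_permCongr (a b : R) (e : α ≃ β) (τ : Equiv.Perm α) :
    involutionWeight a b (e.permCongr τ) = involutionWeight a b τ := by
  simp only [involutionWeight, fixCount_permCongr, Fintype.card_congr e]

theorem involutionSum_congr (a b : R) (e : α ≃ β) :
    involutionSum a b α = involutionSum a b β := by
  unfold involutionSum
  rw [← (e.permCongr).sum_comp]
  simp only [mul_self_permCongr_iff, involutionWeight_permCongr]

theorem fixCount_optionCongr (τ : Equiv.Perm α) :
    fixCount (Equiv.optionCongr τ) = fixCount τ + 1 := by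
  simp only [fixCount, Fintype.sum_option]
  simp [add_comm]

theorem fixCount_swap_mul_optionCongr (τ : Equiv.Perm α) {y : α} (hy : τ y = y) :
    fixCount (Equiv.swap none (some y) * Equiv.optionCongr τ) + 1 = fixCount τ := by
  simp only [fixCount, Fintype.sum_option]
  have h : ∀ x, (if τ x = x then 1 else 0) =
      (if (Equiv.swap none (some y) * Equiv.optionCongr τ) (some x) = some x then 1 else 0) +
        (if x = y then 1 else 0) := by
    intro x
    by_cases hx : x = y
    · subst hx
      simp [hy]
    · have : τ x ≠ y := fun h => hx (τ.injective (h.trans hy.symm))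
      simp [hx, Equiv.swap_apply_of_ne_of_ne, this]
  rw [Finset.sum_congr rfl fun x _ => h x, Finset.sum_add_distrib]
  simp

theorem involutionWeight_optionCongr (a b : R) (τ : Equiv.Perm α) :
    involutionWeight a b (Equiv.optionCongr τ) = a * involutionWeight a b τ := by
  simp only [involutionWeight, fixCount_optionCongr, Fintype.card_option, Nat.add_sub_add_right]
  ring

theorem involutionWeight_swap_mul_optionCongr (a b : R) (τ : Equiv.Perm α) {y : α}
    (hy : τ y = y) :
    a * involutionWeight a b (Equiv.swap none (some y) * Equiv.optionCongr τ) =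
      b * involutionWeight a b τ := by
  have h := fixCount_swap_mul_optionCongr τ hy
  have h' := fixCount_le_card τ
  simp only [involutionWeight, Fintype.card_option, ← h] at h' ⊢
  rw [show (Fintype.card α + 1 -
      fixCount (Equiv.swap none (some y) * Equiv.optionCongr τ)) / 2 =
      (Fintype.card α - (fixCount (Equiv.swap none (some y) * Equiv.optionCongr τ) + 1)) / 2 + 1
    by omega]
  ring

theorem sum_perm_option (F : Equiv.Perm (Option α) → R) :
    ∑ σ, F σ = ∑ τ : Equiv.Perm α, F (Equiv.optionCongr τ) +
      ∑ y : α, ∑ τ : Equiv.Perm α, F (Equiv.swap none (some y) * Equiv.optionCongr τ) := by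
  rw [← (Equiv.Perm.decomposeOption (α := α)).symm.sum_comp, Fintype.sum_prod_type,
    Fintype.sum_option]
  simp [Equiv.Perm.decomposeOption, ← Equiv.Perm.one_def]

/-- The involutions of `Option α` which swap `none` with `some y` contribute `b` times the weight
of the involutions of the complement. -/
theorem sum_involutions_swapping (a b : R) (m : ℕ) (y : Fin (m + 1)) :
    (∑ τ : Equiv.Perm (Fin (m + 1)), if τ * τ = 1 ∧ τ y = y then
      involutionWeight a b (Equiv.swap none (some y) * Equiv.optionCongr τ) else 0) =
      b * involutionSum a b (Fin m) := by
  have hw : ∀ τ : Equiv.Perm (Fin (m + 1)), τ y = y →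
      involutionWeight a b (Equiv.swap none (some y) * Equiv.optionCongr τ) =
        a ^ (fixCount τ - 1) * b ^ ((m + 1 - fixCount τ) / 2 + 1) := by
    intro τ hy
    have h := fixCount_swap_mul_optionCongr τ hy
    have h' := fixCount_le_card τ
    simp only [involutionWeight, Fintype.card_option, Fintype.card_fin] at h' ⊢
    congr 2 <;> omega
  have e : ∀ τ : Equiv.Perm (Fin (m + 1)),
      (finSuccEquiv' y).permCongr τ none = none ↔ τ y = y := by
    intro τ
    rw [Equiv.permCongr_apply, finSuccEquiv'_symm_none, ← Equiv.eq_symm_apply,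
      finSuccEquiv'_symm_none]
  calc _ = ∑ ρ : Equiv.Perm (Option (Fin m)), if ρ * ρ = 1 ∧ ρ none = none then
          a ^ (fixCount ρ - 1) * b ^ ((m + 1 - fixCount ρ) / 2 + 1) else 0 := by
        rw [← Equiv.sum_comp ((finSuccEquiv' y).permCongr)]
        refine Finset.sum_congr rfl fun τ _ => ?_
        simp only [mul_self_permCongr_iff, fixCount_permCongr, e]
        split_ifs with h
        · exact hw τ h.2
        · rfl
    _ = _ := by
        rw [sum_perm_option]
        simp only [mul_self_optionCongr_iff, fixCount_optionCongr]
        simp only [Equiv.optionCongr_apply, Option.map_none, and_true, Equiv.Perm.mul_apply,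
          Equiv.swap_apply_left, reduceCtorEq, and_false, if_false, Finset.sum_const_zero, add_zero,
          involutionSum, Finset.mul_sum, involutionWeight, Fintype.card_fin]
        refine Finset.sum_congr rfl fun τ _ => ?_
        split_ifs
        · rw [Nat.add_sub_cancel, Nat.add_sub_add_right]
          ring
        · simp

theorem involutionSum_add_two (a b : R) (m : ℕ) :
    involutionSum a b (Fin (m + 2)) =
      a * involutionSum a b (Fin (m + 1)) + ((m + 1 : ℕ) : R) * b * involutionSum a b (Fin m) := by
  rw [involutionSum_congr a b (finSuccEquiv (m + 1)), involutionSum, sum_perm_option]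
  simp only [mul_self_optionCongr_iff, mul_self_swap_mul_optionCongr_iff,
    involutionWeight_optionCongr, sum_involutions_swapping]
  congr 1
  · simp [involutionSum, Finset.mul_sum, mul_ite]
  · simp [mul_assoc]

end Involutions

theorem card_excedances_eq {n : ℕ} (τ : Equiv.Perm (Fin n)) (h : τ * τ = 1) :
    #{i | i < τ i} = (n - fixCount τ) / 2 := by
  have hh : ∀ x, τ (τ x) = x := fun x => Equiv.ext_iff.1 h x
  have h1 : #{i | i < τ i} = #{i | τ i < i} := by
    rw [Finset.card_filter, Finset.card_filter, ← Equiv.sum_comp τ]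
    simp [hh]
  have h2 : fixCount τ + #{i | i < τ i} + #{i | τ i < i} = n := by
    rw [fixCount, Finset.card_filter, Finset.card_filter, ← Finset.sum_add_distrib,
      ← Finset.sum_add_distrib]
    calc _ = ∑ i : Fin n, 1 := by
          refine Finset.sum_congr rfl fun i _ => ?_
          rcases lt_trichotomy i (τ i) with h | h | h
          · simp [h, h.ne', h.not_gt]
          · simp [← h]
          · simp [h, h.ne, h.not_gt]
      _ = n := by simp
  omega

theorem isCPInvolution_iff {r n : ℕ} (z : Fin n → ZMod r) (τ : Equiv.Perm (Fin n)) :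
    IsCPInvolution (z, τ) ↔ τ * τ = 1 ∧ ∀ i, z i + z (τ i) = 0 := by
  unfold IsCPInvolution cpMul cpOne
  simp only [Prod.mk.injEq, funext_iff]
  rw [and_comm]
  refine and_congr_right fun h => ?_
  rw [inv_eq_of_mul_eq_one_left h]

/-- The contribution of the position `i` with color `c` to the weight of a colored involution. -/
noncomputable def colorWeight (r : ℕ) {n : ℕ} (τ : Equiv.Perm (Fin n)) (i : Fin n) (c : ZMod r) :
    MvPolynomial (Fin 3) ℤ :=
  if τ i = i then X 0 * X 2 ^ c.val
  else if i < τ i then (if c = 0 then X 1 else X 2 ^ r) else 1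

/-- The colors which may be chosen freely at the position `i`; the color of the larger element of a
2-cycle is determined by that of the smaller one, and is replaced by `0`. -/
def colorChoices (r : ℕ) [NeZero r] {n : ℕ} (τ : Equiv.Perm (Fin n)) (i : Fin n) :
    Finset (ZMod r) :=
  if τ i = i then ({c | c + c = 0} : Finset (ZMod r)) else if i < τ i then Finset.univ else {0}

theorem sum_self_neg_colors (r : ℕ) [NeZero r] :
    ∑ c : ZMod r with c + c = 0, (X 0 * X 2 ^ c.val : MvPolynomial (Fin 3) ℤ) = X 0 * muZ r := by
  have hc : ∀ c : ZMod r, c + c = 0 ↔ c = 0 ∨ 2 * c.val = r := fun c => by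
    rw [← ZMod.neg_eq_self_iff, neg_eq_iff_add_eq_zero]
  rw [← Finset.mul_sum, muZ]
  congr 1
  split_ifs with he
  · obtain ⟨k, hk⟩ := he
    have hr := NeZero.pos r
    have hv : ((k : ℕ) : ZMod r).val = k := ZMod.val_cast_of_lt (by omega)
    have hne : (0 : ZMod r) ≠ (k : ZMod r) := fun h => by
      rw [← h, ZMod.val_zero] at hv
      omega
    have : ({c | c + c = 0} : Finset (ZMod r)) = {0, (k : ZMod r)} := by
      ext c
      simp only [Finset.mem_filter, Finset.mem_univ, true_and, hc, Finset.mem_insert,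
        Finset.mem_singleton]
      refine or_congr_right ⟨fun h => ?_, fun h => ?_⟩
      · rw [← ZMod.natCast_zmod_val c]
        congr 1
        omega
      · rw [h, hv]
        omega
    rw [this, Finset.sum_pair hne, hv, ZMod.val_zero, pow_zero, show r / 2 = k by omega]
  · have : ({c | c + c = 0} : Finset (ZMod r)) = {0} := by
      ext c
      simp only [Finset.mem_filter, Finset.mem_univ, true_and, hc, Finset.mem_singleton]
      refine or_iff_left fun h => he ⟨c.val, by omega⟩
    simp [this]

theorem sum_cycle_colors (r : ℕ) [NeZero r] :
    ∑ c : ZMod r, (if c = 0 then X 1 else X 2 ^ r : MvPolynomial (Fin 3) ℤ) =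
      X 1 + ((r - 1 : ℕ) : MvPolynomial (Fin 3) ℤ) * X 2 ^ r := by
  rw [← Finset.add_sum_erase _ _ (Finset.mem_univ (0 : ZMod r)), if_pos rfl,
    Finset.sum_congr rfl fun c hc => if_neg (Finset.ne_of_mem_erase hc)]
  simp [ZMod.card]

theorem csum_eq {r n : ℕ} [NeZero r] (z : Fin n → ZMod r) (τ : Equiv.Perm (Fin n))
    (h : τ * τ = 1) (hz : ∀ i, z i + z (τ i) = 0) :
    csum (z, τ) = ∑ i, if τ i = i then (z i).val
      else if i < τ i then (if z i = 0 then 0 else r) else 0 := by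
  have hh : ∀ x, τ (τ x) = x := fun x => Equiv.ext_iff.1 h x
  have h1 : ∑ i, (if τ i < i then (z i).val else 0) =
      ∑ i, if i < τ i then (z (τ i)).val else 0 := by
    rw [← Equiv.sum_comp τ]
    simp [hh]
  calc csum (z, τ) = ∑ i, ((if τ i < i then (z i).val else 0) +
        if τ i < i then 0 else (z i).val) := by
        refine Finset.sum_congr rfl fun i _ => ?_
        split_ifs <;> simp
    _ = _ := by
        rw [Finset.sum_add_distrib, h1, ← Finset.sum_add_distrib]
        refine Finset.sum_congr rfl fun i _ => ?_
        rw [← neg_eq_of_add_eq_zero_right (hz i), ZMod.neg_val]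
        have := (z i).val_lt
        rcases lt_trichotomy i (τ i) with h | h | h
        · simp only [h, h.not_gt, h.ne', if_true, if_false]
          split_ifs with h0
          · simp [h0]
          · omega
        · simp [← h]
        · simp [h, h.not_gt, h.ne]

theorem weight_eq_prod {r n : ℕ} [NeZero r] (z : Fin n → ZMod r) (τ : Equiv.Perm (Fin n))
    (h : τ * τ = 1) (hz : ∀ i, z i + z (τ i) = 0) :
    (X 0 ^ fixc (z, τ) * X 1 ^ excA (z, τ) * X 2 ^ csum (z, τ) : MvPolynomial (Fin 3) ℤ) =
      ∏ i, colorWeight r τ i (z i) := by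
  have hfix : fixc (z, τ) = ∑ i, if τ i = i then 1 else 0 := by
    rw [fixc, Nat.card_eq_fintype_card, Fintype.card_subtype, Finset.card_filter]
  have hexc : excA (z, τ) = ∑ i, if i < τ i ∧ z i = 0 then 1 else 0 := by
    rw [excA, Nat.card_eq_fintype_card, Fintype.card_subtype, Finset.card_filter]
    refine Finset.sum_congr rfl fun i _ => if_congr ?_ rfl rfl
    change (i : ℕ) + 1 < n ∧ z (τ i) = 0 ∧ i < τ i ↔ _
    rw [← neg_eq_of_add_eq_zero_right (hz i), neg_eq_zero]
    have := (τ i).isLt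
    rw [Fin.lt_def]
    constructor
    · tauto
    · rintro ⟨h1, h2⟩
      exact ⟨by omega, h2, h1⟩
  rw [hfix, hexc, csum_eq z τ h hz, ← Finset.prod_pow_eq_pow_sum, ← Finset.prod_pow_eq_pow_sum,
    ← Finset.prod_pow_eq_pow_sum, ← Finset.prod_mul_distrib, ← Finset.prod_mul_distrib]
  refine Finset.prod_congr rfl fun i _ => ?_
  unfold colorWeight
  rcases lt_trichotomy i (τ i) with h | h | h
  · simp only [h, h.ne', if_true, if_false, true_and]
    split_ifs <;> simp
  · simp [← h]
  · simp [h.ne, h.not_gt]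

theorem sum_colors_eq_prod {r n : ℕ} [NeZero r] (τ : Equiv.Perm (Fin n)) (h : τ * τ = 1) :
    ∑ z : Fin n → ZMod r with ∀ i, z i + z (τ i) = 0, ∏ i, colorWeight r τ i (z i) =
      ∏ i, ∑ c ∈ colorChoices r τ i, colorWeight r τ i c := by
  have hh : ∀ x, τ (τ x) = x := fun x => Equiv.ext_iff.1 h x
  rw [Finset.prod_univ_sum]
  refine Finset.sum_nbij' (fun z i => if τ i < i then 0 else z i)
    (fun y i => if τ i < i then -y (τ i) else y i) ?_ ?_ ?_ ?_ ?_
  · intro z hz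
    simp only [Finset.mem_filter, Finset.mem_univ, true_and] at hz
    rw [Fintype.mem_piFinset]
    intro i
    unfold colorChoices
    have := hz i
    rcases lt_trichotomy i (τ i) with h | h | h
    · simp [h, h.ne']
    · rw [← h] at this
      simp [← h, this]
    · simp [h, h.ne, h.not_gt]
  · intro y hy
    rw [Fintype.mem_piFinset] at hy
    simp only [Finset.mem_filter, Finset.mem_univ, true_and, hh]
    intro i
    have := hy i
    rcases lt_trichotomy i (τ i) with h | h | h
    · simp [h, h.not_gt]
    · simpa [← h, colorChoices] using this
    · simp [h, h.not_gt]
  · intro z hz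
    simp only [Finset.mem_filter, Finset.mem_univ, true_and] at hz
    funext i
    simp only [hh]
    split_ifs with h1 h2
    · exact absurd h1 h2.not_gt
    · exact neg_eq_of_add_eq_zero_left (hz i)
    · rfl
  · intro y hy
    rw [Fintype.mem_piFinset] at hy
    funext i
    have := hy i
    rcases lt_trichotomy i (τ i) with h | h | h
    · simp [h.not_gt]
    · simp [← h]
    · simpa [h, h.not_gt, h.ne, colorChoices, eq_comm] using this
  · intro z _
    refine Finset.prod_congr rfl fun i _ => ?_
    unfold colorWeight
    rcases lt_trichotomy i (τ i) with h | h | h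
    · simp [h.not_gt]
    · simp [← h]
    · simp [h.not_gt, h.ne]

theorem prod_sum_colorWeight {r n : ℕ} [NeZero r] (τ : Equiv.Perm (Fin n)) (h : τ * τ = 1) :
    ∏ i, ∑ c ∈ colorChoices r τ i, colorWeight r τ i c =
      involutionWeight (X 0 * muZ r)
        (X 1 + ((r - 1 : ℕ) : MvPolynomial (Fin 3) ℤ) * X 2 ^ r) τ := by
  rw [involutionWeight, Fintype.card_fin, ← card_excedances_eq τ h, Finset.card_filter, fixCount,
    ← Finset.prod_pow_eq_pow_sum, ← Finset.prod_pow_eq_pow_sum, ← Finset.prod_mul_distrib]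
  refine Finset.prod_congr rfl fun i _ => ?_
  unfold colorChoices colorWeight
  rcases lt_trichotomy i (τ i) with h | h | h
  · simp only [h, h.ne', if_true, if_false, sum_cycle_colors, pow_zero, pow_one, one_mul]
  · simp only [← h, lt_irrefl, if_true, if_false, sum_self_neg_colors, pow_zero, pow_one, mul_one]
  · simp [h.ne, h.not_gt]

theorem fpoly_one_eq_involutionSum (r n : ℕ) [NeZero r] :
    fpoly r 1 n = involutionSum (X 0 * muZ r)
      (X 1 + ((r - 1 : ℕ) : MvPolynomial (Fin 3) ℤ) * X 2 ^ r) (Fin n) := by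
  rw [fpoly, Fintype.sum_prod_type_right, involutionSum]
  refine Finset.sum_congr rfl fun τ _ => ?_
  simp only [isCPInvolution_iff, one_dvd, and_true]
  split_ifs with h
  · rw [← prod_sum_colorWeight τ h, ← sum_colors_eq_prod τ h, Finset.sum_filter]
    refine Finset.sum_congr rfl fun z _ => ?_
    simp only [h, true_and]
    split_ifs with hz
    · exact weight_eq_prod z τ h hz
    · rfl
  · simp [h]

/-- Recurrence for `f_{r,1,n}`:
`f_{r,1,0} = 1`, `f_{r,1,1} = u·μ_r`, and for `n ≥ 2`,
`f_{r,1,n} = u·μ_r·f_{r,1,n−1} + (n−1)(v + (r−1)wʳ)·f_{r,1,n−2}`. -/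
theorem fpoly_recurrence (r : ℕ) [NeZero r] (hr : 1 ≤ r) :
    fpoly r 1 0 = 1 ∧
    fpoly r 1 1 = X 0 * muZ r ∧
    ∀ n : ℕ, 2 ≤ n →
      fpoly r 1 n =
        X 0 * muZ r * fpoly r 1 (n - 1) +
          ((n - 1 : ℕ) : MvPolynomial (Fin 3) ℤ) *
            (X 1 + ((r - 1 : ℕ) : MvPolynomial (Fin 3) ℤ) * X 2 ^ r) * fpoly r 1 (n - 2) := by
  simp only [fpoly_one_eq_involutionSum]
  refine ⟨?_, ?_, fun n hn => ?_⟩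
  · simp [involutionSum, involutionWeight, fixCount]
  · simp [involutionSum, involutionWeight, fixCount]
  · obtain ⟨m, rfl⟩ := Nat.exists_eq_add_of_le' hn
    exact involutionSum_add_two _ _ m
end

section
/- Let r ≥ 1 be odd, n ≥ 0, and m = r·k for a natural number k. The number of involutions π ∈ I_{r,n} with exc^Clr(π) = m equals k!·C(n; k, k, n−2k)·(r/2)^k, i.e. (k!/2^k)·C(n; k, k, n−2k)·r^k. -/
open Finset MvPolynomial

/-- The multinomial coefficient `C(n; a₁, …, a_k) = n!/(a₁!⋯a_k!)` when all
entries are nonnegative and sum to `n`, and `0` otherwise. -/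
def multinomialZ (n : ℤ) (l : List ℤ) : ℕ :=
  if (∀ a ∈ l, 0 ≤ a) ∧ l.sum = n then
    n.toNat.factorial / (l.map fun a => a.toNat.factorial).prod
  else 0

theorem isCPInvolution_iff_s9 {r n : ℕ} (π : ColoredPerm r n) :
    IsCPInvolution π ↔ π.2 ^ 2 = 1 ∧ ∀ i, π.1 (π.2 i) = -π.1 i := by
  rw [IsCPInvolution, cpMul, cpOne, Prod.mk.injEq, funext_iff, ← pow_two, and_comm]
  refine and_congr_right fun h => forall_congr' fun i => ?_
  rw [inv_eq_of_mul_eq_one_left (by rwa [pow_two] at h), eq_neg_iff_add_eq_zero, add_comm]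

theorem Equiv.Perm.apply_apply_of_sq_eq_one {α : Type*} {τ : Equiv.Perm α} (h : τ ^ 2 = 1)
    (i : α) : τ (τ i) = i := by
  rw [← Equiv.Perm.mul_apply, ← pow_two, h, Equiv.Perm.one_apply]

theorem ZMod.eq_zero_of_eq_neg_of_odd {r : ℕ} (hodd : Odd r) {a : ZMod r} (h : a = -a) :
    a = 0 :=
  (ZMod.add_self_eq_zero_iff_eq_zero hodd).1 (eq_neg_iff_add_eq_zero.1 h)

/-- Summing over the orbits of an involution: the non-fixed points pair up as `{i, τ i}`. -/
theorem sum_eq_sum_lt_add_of_sq_eq_one {n : ℕ} {M : Type*} [AddCommMonoid M]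
    {τ : Equiv.Perm (Fin n)} (h : τ ^ 2 = 1) (f : Fin n → M) (hf : ∀ i, τ i = i → f i = 0) :
    ∑ i, f i = ∑ i with i < τ i, (f i + f (τ i)) := by
  have hτ := Equiv.Perm.apply_apply_of_sq_eq_one h
  have hgt : ∑ i with i < τ i, f (τ i) = ∑ i with τ i < i, f i := by
    refine Finset.sum_equiv τ (fun i => ?_) (fun i _ => rfl)
    simp [hτ]
  rw [Finset.sum_add_distrib, hgt, ← Finset.sum_filter_add_sum_filter_not univ (fun i => i < τ i)]
  congr 1
  symm
  refine Finset.sum_subset (fun i => ?_) (fun i hi hi' => hf i ?_)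
  · simpa using le_of_lt
  · simp only [mem_filter, mem_univ, true_and, not_lt] at hi hi'
    exact le_antisymm hi hi'

theorem excClr_eq_of_isCPInvolution {r n : ℕ} [NeZero r] (hodd : Odd r) {π : ColoredPerm r n}
    (h : IsCPInvolution π) : excClr π = r * #{i | i < π.2 i} := by
  obtain ⟨hsq, hz⟩ := (isCPInvolution_iff_s9 π).1 h
  have hcsum : csum π = ∑ i with i < π.2 i, ((π.1 i).val + (π.1 (π.2 i)).val) := by
    refine sum_eq_sum_lt_add_of_sq_eq_one hsq (fun i => (π.1 i).val) fun i hi => ?_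
    have hi' := hz i
    rw [hi] at hi'
    simp [ZMod.eq_zero_of_eq_neg_of_odd hodd hi']
  have hexc : excA π = ∑ i with i < π.2 i, if π.1 i = 0 then 1 else 0 := by
    rw [excA, Nat.card_eq_fintype_card, Fintype.card_subtype, Finset.sum_boole, Nat.cast_id,
      Finset.filter_filter]
    congr 1
    ext i
    simp only [mem_filter, mem_univ, true_and, hz, neg_eq_zero]
    constructor
    · tauto
    · rintro ⟨hi, h0⟩
      exact ⟨by have := (π.2 i).isLt; have := Fin.lt_def.1 hi; omega, h0, hi⟩
  rw [excClr, hcsum, hexc, Finset.mul_sum, ← Finset.sum_add_distrib, mul_comm r,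
    ← smul_eq_mul, ← Finset.sum_const]
  refine Finset.sum_congr rfl fun i _ => ?_
  rw [hz, ZMod.neg_val]
  have := ZMod.val_lt (π.1 i)
  split_ifs with h0
  · simp [h0]
  · omega

theorem card_support_of_sq_eq_one {n : ℕ} {τ : Equiv.Perm (Fin n)} (h : τ ^ 2 = 1) :
    #τ.support = 2 * #{i | i < τ i} := by
  have hτ := Equiv.Perm.apply_apply_of_sq_eq_one h
  have key := sum_eq_sum_lt_add_of_sq_eq_one h (fun i => if τ i = i then 0 else 1) (by simp)
  have hsum : ∑ i with i < τ i, ((if τ i = i then 0 else 1) +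
      (if τ (τ i) = τ i then 0 else 1)) = ∑ i with i < τ i, 2 := by
    refine Finset.sum_congr rfl fun i hi => ?_
    have hi : i < τ i := by simpa using hi
    simp [hτ, hi.ne, hi.ne']
  rw [hsum, Finset.sum_const, smul_eq_mul, mul_comm] at key
  rw [← key, Finset.card_eq_sum_ones, Equiv.Perm.support, Finset.sum_filter]
  exact Finset.sum_congr rfl fun i _ => by by_cases hi : τ i = i <;> simp [hi]

theorem cycleType_eq_replicate_two_iff {n k : ℕ} (τ : Equiv.Perm (Fin n)) :
    τ.cycleType = Multiset.replicate k 2 ↔ τ ^ 2 = 1 ∧ #{i | i < τ i} = k := by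
  constructor
  · intro h
    have hsq : τ ^ 2 = 1 := Equiv.Perm.pow_prime_eq_one_iff.2 fun c hc => by
      rw [h] at hc
      exact Multiset.eq_of_mem_replicate hc
    refine ⟨hsq, ?_⟩
    have hs := τ.sum_cycleType
    rw [card_support_of_sq_eq_one hsq, h, Multiset.sum_replicate, smul_eq_mul] at hs
    omega
  · rintro ⟨hsq, hk⟩
    have hrep := Multiset.eq_replicate_card.2 (Equiv.Perm.pow_prime_eq_one_iff.1 hsq)
    have hs := τ.sum_cycleType
    rw [card_support_of_sq_eq_one hsq, hrep, Multiset.sum_replicate, smul_eq_mul, hk] at hs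
    rw [hrep]
    congr 1
    omega

/-- The colorings compatible with an involution are determined by the colors of the smaller
elements of its two-cycles. -/
def compatibleColoringEquiv {r n : ℕ} (hodd : Odd r) {τ : Equiv.Perm (Fin n)} (h : τ ^ 2 = 1) :
    {z : Fin n → ZMod r // ∀ i, z (τ i) = -z i} ≃ ({i // i < τ i} → ZMod r) where
  toFun z i := z.1 i
  invFun c := ⟨fun i => if hi : i < τ i then c ⟨i, hi⟩ else
      if hi' : τ i < i then
        -c ⟨τ i, by rwa [Equiv.Perm.apply_apply_of_sq_eq_one h]⟩ else 0, fun i => by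
    have hτ := Equiv.Perm.apply_apply_of_sq_eq_one h
    rcases lt_trichotomy i (τ i) with hi | hi | hi
    · simp [hτ, hi, hi.not_gt]
    · simp [← hi]
    · simp [hτ, hi, hi.not_gt]⟩
  left_inv z := by
    have hτ := Equiv.Perm.apply_apply_of_sq_eq_one h
    ext i
    rcases lt_trichotomy i (τ i) with hi | hi | hi
    · simp [hi]
    · have hz := z.2 i
      rw [← hi] at hz
      simp [← hi, ZMod.eq_zero_of_eq_neg_of_odd hodd hz]
    · simp [hi, hi.not_gt, z.2 i]
  right_inv c := by
    ext i
    simp [i.2]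

theorem card_involutions_excClr_eq_mul_pow {r n k : ℕ} [NeZero r] (hodd : Odd r) :
    Nat.card {π : ColoredPerm r n // IsCPInvolution π ∧ excClr π = r * k} =
      #{τ : Equiv.Perm (Fin n) | τ.cycleType = Multiset.replicate k 2} * r ^ k := by
  have hiff (π : ColoredPerm r n) : IsCPInvolution π ∧ excClr π = r * k ↔
      π.2.cycleType = Multiset.replicate k 2 ∧ ∀ i, π.1 (π.2 i) = -π.1 i := by
    rw [cycleType_eq_replicate_two_iff]
    constructor
    · rintro ⟨h, hk⟩
      rw [excClr_eq_of_isCPInvolution hodd h] at hk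
      have h' := (isCPInvolution_iff_s9 π).1 h
      exact ⟨⟨h'.1, Nat.eq_of_mul_eq_mul_left (NeZero.pos r) hk⟩, h'.2⟩
    · rintro ⟨⟨hsq, hk⟩, hz⟩
      have h := (isCPInvolution_iff_s9 π).2 ⟨hsq, hz⟩
      exact ⟨h, by rw [excClr_eq_of_isCPInvolution hodd h, hk]⟩
  let e : {π : ColoredPerm r n // IsCPInvolution π ∧ excClr π = r * k} ≃
      Σ τ : {τ : Equiv.Perm (Fin n) // τ.cycleType = Multiset.replicate k 2},
        {z : Fin n → ZMod r // ∀ i, z (τ.1 i) = -z i} :=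
    { toFun := fun π => ⟨⟨π.1.2, ((hiff π.1).1 π.2).1⟩, ⟨π.1.1, ((hiff π.1).1 π.2).2⟩⟩
      invFun := fun x => ⟨(x.2.1, x.1.1), (hiff _).2 ⟨x.1.2, x.2.2⟩⟩
      left_inv := fun _ => rfl
      right_inv := fun _ => rfl }
  have hfib (τ : {τ : Equiv.Perm (Fin n) // τ.cycleType = Multiset.replicate k 2}) :
      Nat.card {z : Fin n → ZMod r // ∀ i, z (τ.1 i) = -z i} = r ^ k := by
    obtain ⟨hsq, hk⟩ := (cycleType_eq_replicate_two_iff τ.1).1 τ.2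
    rw [Nat.card_congr (compatibleColoringEquiv hodd hsq), Nat.card_fun, Nat.card_zmod,
      Nat.card_eq_fintype_card, Fintype.card_subtype, hk]
  rw [Nat.card_congr e, Nat.card_sigma, Finset.sum_congr rfl fun τ _ => hfib τ, Finset.sum_const,
    smul_eq_mul, Finset.card_univ, Fintype.card_subtype]

theorem card_cycleType_eq_replicate_two {n k : ℕ} :
    (#{τ : Equiv.Perm (Fin n) | τ.cycleType = Multiset.replicate k 2} : ℚ) =
      k.factorial * multinomialZ n [(k : ℤ), (k : ℤ), (n : ℤ) - 2 * k] / 2 ^ k := by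
  have hprod : ∏ a ∈ (Multiset.replicate k 2).toFinset,
      ((Multiset.replicate k 2).count a).factorial = k.factorial := by
    rcases eq_or_ne k 0 with rfl | hk
    · simp
    · simp [Multiset.toFinset_replicate, hk]
  have hcard := Equiv.Perm.card_of_cycleType_mul_eq (α := Fin n) (Multiset.replicate k 2)
  rw [hprod, Multiset.sum_replicate, Multiset.prod_replicate, Fintype.card_fin, smul_eq_mul]
    at hcard
  have htwo : ∀ a ∈ Multiset.replicate k 2, 2 ≤ a :=
    fun a ha => (Multiset.eq_of_mem_replicate ha).ge
  by_cases hkn : k * 2 ≤ n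
  · rw [if_pos ⟨hkn, htwo⟩] at hcard
    have hsub : ((n : ℤ) - 2 * k).toNat = n - k * 2 := by omega
    have hdvd : k.factorial * (k.factorial * (n - k * 2).factorial) ∣ n.factorial := by
      have h1 : k.factorial * k.factorial ∣ (k * 2).factorial := by
        rw [mul_two]; exact Nat.factorial_mul_factorial_dvd_factorial_add k k
      have h2 := Nat.factorial_mul_factorial_dvd_factorial hkn
      rw [← mul_assoc]
      exact (mul_dvd_mul_right h1 _).trans h2
    have hm : multinomialZ n [(k : ℤ), (k : ℤ), (n : ℤ) - 2 * k] =
        n.factorial / (k.factorial * (k.factorial * (n - k * 2).factorial)) := by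
      rw [multinomialZ, if_pos]
      · simp [hsub]
      · constructor
        · simp; omega
        · simp; ring
    have hk0 : (k.factorial : ℚ) ≠ 0 := by exact_mod_cast k.factorial_ne_zero
    have hn0 : ((n - k * 2).factorial : ℚ) ≠ 0 := by exact_mod_cast Nat.factorial_ne_zero _
    rw [hm, Nat.cast_div hdvd (by push_cast; positivity), ← hcard]
    push_cast
    field_simp
  · rw [if_neg fun h => hkn h.1] at hcard
    have h0 : #{τ : Equiv.Perm (Fin n) | τ.cycleType = Multiset.replicate k 2} = 0 := by
      refine (Nat.mul_eq_zero.1 hcard).resolve_right ?_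
      positivity
    have hm : multinomialZ n [(k : ℤ), (k : ℤ), (n : ℤ) - 2 * k] = 0 := by
      rw [multinomialZ, if_neg]
      rintro ⟨h, -⟩
      have := h ((n : ℤ) - 2 * k) (by simp)
      omega
    rw [h0, hm]
    simp

/-- For odd `r ≥ 1` and `m = r·k`, the number of involutions
`π ∈ I_{r,n}` with `exc^Clr π = m` equals `k!·C(n; k, k, n−2k)·(r/2)^k`. -/
theorem card_involutions_excClr_odd (r n k : ℕ) (hr : 1 ≤ r) (hodd : Odd r) :
    (Nat.card {π : ColoredPerm r n //
        IsCPInvolution π ∧ excClr π = r * k} : ℚ) =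
      (k.factorial : ℚ) *
        (multinomialZ n [(k : ℤ), (k : ℤ), (n : ℤ) - 2 * k] : ℚ) * ((r : ℚ) / 2) ^ k := by
  have : NeZero r := ⟨by omega⟩
  rw [card_involutions_excClr_eq_mul_pow hodd, Nat.cast_mul, card_cycleType_eq_replicate_two,
    Nat.cast_pow, div_pow]
  ring
end

section
/- Let r ≥ 1 be odd and p ≥ 1 with p | r. Then every involution of G_{r,n} lies in G_{r,p,n}, i.e. I_{r,p,n} = I_{r,n}; in particular, for every involution π ∈ G_{r,n} one has csum(π) ≡ 0 (mod p). -/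
open Finset MvPolynomial

/-- The sum of the colors, taken in `ZMod r`, is the class of `csum π`. -/
theorem csum_cast {r n : ℕ} [NeZero r] (π : ColoredPerm r n) :
    (csum π : ZMod r) = ∑ i, π.1 i := by
  simp [csum]

/-- Twice the color sum of an involution vanishes modulo `r`. -/
theorem IsCPInvolution.dvd_two_mul_csum {r n : ℕ} [NeZero r] {π : ColoredPerm r n}
    (h : IsCPInvolution π) : r ∣ 2 * csum π := by
  have hz : ∀ i, π.1 i + π.1 (π.2⁻¹ i) = 0 := congr_fun (congr_arg Prod.fst h)
  have hsum : ∑ i, (π.1 i + π.1 (π.2⁻¹ i)) = 0 := Finset.sum_eq_zero fun i _ => hz i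
  rw [Finset.sum_add_distrib, Equiv.sum_comp π.2⁻¹ π.1, ← csum_cast, ← two_mul] at hsum
  rw [← ZMod.natCast_eq_zero_iff]
  exact_mod_cast hsum

/-- For odd `r`, the color sum of an involution is divisible by `r`. -/
theorem IsCPInvolution.dvd_csum {r n : ℕ} (hodd : Odd r) {π : ColoredPerm r n}
    (h : IsCPInvolution π) : r ∣ csum π :=
  haveI : NeZero r := ⟨hodd.pos.ne'⟩
  (Nat.coprime_two_right.mpr hodd).dvd_of_dvd_mul_left h.dvd_two_mul_csum

/-- For odd `r ≥ 1` and `p ≥ 1` with `p ∣ r`, every involution of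
`G_{r,n}` lies in `G_{r,p,n}`, i.e. `I_{r,p,n} = I_{r,n}`; in particular every
involution `π` satisfies `csum π ≡ 0 (mod p)`. -/
theorem involutions_grpn_eq_grn (r p n : ℕ) (hr : 1 ≤ r) (hodd : Odd r)
    (hp : 1 ≤ p) (hpr : p ∣ r) :
    {π : ColoredPerm r n | IsCPInvolution π ∧ p ∣ csum π} =
      {π : ColoredPerm r n | IsCPInvolution π} ∧
    ∀ π : ColoredPerm r n, IsCPInvolution π → p ∣ csum π := by
  have hdvd : ∀ π : ColoredPerm r n, IsCPInvolution π → p ∣ csum π :=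
    fun _ h => hpr.trans (h.dvd_csum hodd)
  exact ⟨Set.ext fun π => and_iff_left_of_imp (hdvd π), hdvd⟩
end
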